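/- arXiv:1807.11702 — 2 statements merged into one kernel-verified Lean document; each statement's English description precedes it below -/
import Mathlib

section
/- Correctness of the reduction from Common Substring with k Mismatches to mappability: let T1, T2 be strings of lengths n1 and n2 over an alphabet Σ, let k ≥ 0, and let d satisfy 1 ≤ d ≤ min(n1, n2). Let U = T1 · T2 (concatenation) and V = T1 · T2[1..d−1] (T1 followed by the length-(d−1) prefix of T2), and let A and B denote the (k,d)-mappability arrays of U and V respectively, i.e., A[i] = |{ j ≠ i : d_H(U_i^d, U_j^d) = k }| over valid positions j of U and B[i] = |{ j ≠ i : d_H(V_i^d, V_j^d) = k }| over valid positions j of V. Then for every i with 1 ≤ i ≤ n1 − d + 1, A[i] − B[i] = |{ j : 1 ≤ j ≤ n2 − d + 1, d_H(T1[i..i+d−1], T2[j..j+d−1]) = k }|, i.e., it equals the number of length-d factors (occurrence positions) of T2 at Hamming distance exactly k from T1[i..i+d−1]. -/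
/-- The length-`d` window of the string `X` (with 1-based positions given by a
function `ℕ → α`) starting at position `i`, i.e. `X[i..i+d-1]`. -/
def win {α : Type*} (X : ℕ → α) (i d : ℕ) : Fin d → α :=
  fun p => X (i + p)

/-- Hamming distance between two strings of equal length `d`. -/
def hamm {α : Type*} [DecidableEq α] {d : ℕ} (x y : Fin d → α) : ℕ :=
  (Finset.univ.filter fun p => x p ≠ y p).card

/-- The `(k,d)`-mappability count of a string `X` of length `len` at position `i`:
the number of positions `j ≠ i`, `1 ≤ j ≤ len - d + 1`, with
`d_H(X_i^d, X_j^d) = k`. -/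
def mapEq {α : Type*} [DecidableEq α] (X : ℕ → α) (len d k i : ℕ) : ℕ :=
  ((Finset.Icc 1 (len - d + 1)).filter
    fun j => j ≠ i ∧ hamm (win X i d) (win X j d) = k).card

theorem win_congr {α : Type*} {X Y : ℕ → α} {i j d : ℕ}
    (h : ∀ p < d, X (i + p) = Y (j + p)) : win X i d = win Y j d :=
  funext fun p => h p p.isLt

/-- Splitting an initial segment `1..a+b` into `1..a` and a translate of `1..b` when counting. -/
theorem card_filter_Icc_one_add (a b : ℕ) (P : ℕ → Prop) [DecidablePred P] :
    ((Finset.Icc 1 (a + b)).filter P).card =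
      ((Finset.Icc 1 a).filter P).card +
        ((Finset.Icc 1 b).filter fun j => P (a + j)).card := by
  induction b with
  | zero => simp
  | succ b ih =>
    rw [← Nat.add_assoc, ← Finset.insert_Icc_right_eq_Icc_add_one (by omega),
      ← Finset.insert_Icc_right_eq_Icc_add_one (by omega), Finset.filter_insert,
      Finset.filter_insert]
    by_cases h : P (a + b + 1)
    · rw [if_pos h, if_pos (by exact h), Finset.card_insert_of_notMem (by simp),
        Finset.card_insert_of_notMem (by simp), ih, Nat.add_assoc]
    · rw [if_neg h, if_neg (by exact h), ih]

/-- correctness of the reduction from Common Substring with `k`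
Mismatches to mappability. With `U = T1 · T2` and `V = T1 · T2[1..d−1]`, and
`A`, `B` the `(k,d)`-mappability arrays of `U` and `V`, for every position
`1 ≤ i ≤ n1 − d + 1` of `T1`, `A[i] − B[i]` equals the number of positions
`1 ≤ j ≤ n2 − d + 1` with `d_H(T1[i..i+d−1], T2[j..j+d−1]) = k`. -/
theorem mappability_reduction {α : Type*} [DecidableEq α]
    (T1 T2 U V : ℕ → α) (n1 n2 k d : ℕ)
    (hd1 : 1 ≤ d) (hdn1 : d ≤ n1) (hdn2 : d ≤ n2)
    (hU : ∀ p, 1 ≤ p → p ≤ n1 + n2 →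
      U p = if p ≤ n1 then T1 p else T2 (p - n1))
    (hV : ∀ p, 1 ≤ p → p ≤ n1 + (d - 1) →
      V p = if p ≤ n1 then T1 p else T2 (p - n1))
    (i : ℕ) (hi : 1 ≤ i) (hin : i ≤ n1 - d + 1) :
    (mapEq U (n1 + n2) d k i : ℤ) - (mapEq V (n1 + (d - 1)) d k i : ℤ) =
      ((Finset.Icc 1 (n2 - d + 1)).filter
        fun j => hamm (win T1 i d) (win T2 j d) = k).card := by
  have hUi : win U i d = win T1 i d := win_congr fun p hp => by
    rw [hU _ (by omega) (by omega), if_pos (by omega)]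
  have hUV : ∀ j, 1 ≤ j → j ≤ n1 → win U j d = win V j d := fun j h1 h2 =>
    win_congr fun p hp => by
      rw [hU _ (by omega) (by omega), hV _ (by omega) (by omega)]
  have hUT : ∀ j, 1 ≤ j → j ≤ n2 - d + 1 → win U (n1 + j) d = win T2 j d := fun j h1 h2 =>
    win_congr fun p hp => by
      rw [hU _ (by omega) (by omega), if_neg (by omega)]
      congr 1
      omega
  have hleft : ((Finset.Icc 1 n1).filter
      fun j => j ≠ i ∧ hamm (win U i d) (win U j d) = k).card =
      mapEq V (n1 + (d - 1)) d k i := by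
    rw [mapEq, show n1 + (d - 1) - d + 1 = n1 by omega]
    refine congrArg Finset.card (Finset.filter_congr fun j hj => ?_)
    rw [Finset.mem_Icc] at hj
    rw [hUV i hi (by omega), hUV j hj.1 hj.2]
  have hright : ((Finset.Icc 1 (n2 - d + 1)).filter
      fun j => n1 + j ≠ i ∧ hamm (win U i d) (win U (n1 + j) d) = k).card =
      ((Finset.Icc 1 (n2 - d + 1)).filter
        fun j => hamm (win T1 i d) (win T2 j d) = k).card := by
    refine congrArg Finset.card (Finset.filter_congr fun j hj => ?_)
    rw [Finset.mem_Icc] at hj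
    rw [hUi, hUT j hj.1 hj.2]
    exact and_iff_right (by omega)
  have hsplit := card_filter_Icc_one_add n1 (n2 - d + 1)
    fun j => j ≠ i ∧ hamm (win U i d) (win U j d) = k
  rw [hleft, hright] at hsplit
  rw [mapEq, show n1 + n2 - d + 1 = n1 + (n2 - d + 1) by omega, hsplit]
  push_cast
  ring
end

section
/- Decision equivalence in the reduction: with T1, T2, k, d, U, V, A, B as above, there exists a length-d factor of T1 that occurs in T2 with exactly k mismatches (i.e., there exist i ≤ n1 − d + 1 and j ≤ n2 − d + 1 with d_H(T1[i..i+d−1], T2[j..j+d−1]) = k) if and only if A[i] − B[i] > 0 for some i with 1 ≤ i ≤ n1 − d + 1. -/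
/-- If `X` and `Y` have the same windows at `i` and at every window position of `Y`, and `X`
has at least as many window positions, then the count for `X` exceeds the count for `Y` exactly
when some additional window of `X` is at distance `k` from the window at `i`. -/
theorem mapEq_lt_mapEq_iff {α : Type*} [DecidableEq α] {X Y : ℕ → α} {m n d k i : ℕ}
    (hmn : m - d + 1 ≤ n - d + 1) (hi : i ∈ Finset.Icc 1 (m - d + 1))
    (h : ∀ j ∈ Finset.Icc 1 (m - d + 1), win X j d = win Y j d) :
    mapEq Y m d k i < mapEq X n d k i ↔
      ∃ j ∈ Finset.Ioc (m - d + 1) (n - d + 1), hamm (win X i d) (win X j d) = k := by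
  have hY : mapEq Y m d k i = mapEq X m d k i := by
    unfold mapEq
    congr 1
    exact Finset.filter_congr fun j hj => by rw [h i hi, h j hj]
  have hsub : (Finset.Icc 1 (m - d + 1)).filter
        (fun j => j ≠ i ∧ hamm (win X i d) (win X j d) = k) ⊆
      (Finset.Icc 1 (n - d + 1)).filter
        (fun j => j ≠ i ∧ hamm (win X i d) (win X j d) = k) :=
    Finset.filter_subset_filter _ (Finset.Icc_subset_Icc_right hmn)
  rw [hY]
  unfold mapEq
  constructor
  · intro hlt
    obtain ⟨j, hjn, hjm⟩ := Finset.exists_mem_notMem_of_card_lt_card hlt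
    simp only [Finset.mem_filter, Finset.mem_Icc] at hjn hjm
    refine ⟨j, Finset.mem_Ioc.2 ⟨?_, hjn.1.2⟩, hjn.2.2⟩
    by_contra! hle
    exact hjm ⟨⟨hjn.1.1, hle⟩, hjn.2⟩
  · rintro ⟨j, hj, hk⟩
    rw [Finset.mem_Ioc] at hj
    rw [Finset.mem_Icc] at hi
    refine Finset.card_lt_card ((Finset.ssubset_iff_of_subset hsub).2 ⟨j, ?_, ?_⟩)
    · simp only [Finset.mem_filter, Finset.mem_Icc]
      exact ⟨⟨by omega, hj.2⟩, by omega, hk⟩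
    · simp only [Finset.mem_filter, Finset.mem_Icc]
      omega

/-- decision equivalence in the reduction. With `U = T1 · T2` and
`V = T1 · T2[1..d−1]`, and `A`, `B` the `(k,d)`-mappability arrays of `U` and
`V`, there exist positions `1 ≤ i ≤ n1 − d + 1` and `1 ≤ j ≤ n2 − d + 1` with
`d_H(T1[i..i+d−1], T2[j..j+d−1]) = k` if and only if `A[i] − B[i] > 0` for some
`1 ≤ i ≤ n1 − d + 1`. -/
theorem mappability_reduction_decision {α : Type*} [DecidableEq α]
    (T1 T2 U V : ℕ → α) (n1 n2 k d : ℕ)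
    (hd1 : 1 ≤ d) (hdn1 : d ≤ n1) (hdn2 : d ≤ n2)
    (hU : ∀ p, 1 ≤ p → p ≤ n1 + n2 →
      U p = if p ≤ n1 then T1 p else T2 (p - n1))
    (hV : ∀ p, 1 ≤ p → p ≤ n1 + (d - 1) →
      V p = if p ≤ n1 then T1 p else T2 (p - n1)) :
    (∃ i ∈ Finset.Icc 1 (n1 - d + 1), ∃ j ∈ Finset.Icc 1 (n2 - d + 1),
        hamm (win T1 i d) (win T2 j d) = k) ↔
      ∃ i ∈ Finset.Icc 1 (n1 - d + 1),
        (0 : ℤ) < (mapEq U (n1 + n2) d k i : ℤ) - (mapEq V (n1 + (d - 1)) d k i : ℤ) := by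
  refine exists_congr fun i => and_congr_right fun hi => ?_
  rw [Finset.mem_Icc] at hi
  have hT1 : win U i d = win T1 i d := win_congr fun p hp => by
    rw [hU _ (by omega) (by omega), if_pos (by omega)]
  have hT2 : ∀ j ∈ Finset.Icc 1 (n2 - d + 1), win U (n1 + j) d = win T2 j d := fun j hj =>
    win_congr fun p hp => by
      rw [Finset.mem_Icc] at hj
      rw [hU _ (by omega) (by omega), if_neg (by omega)]
      congr 1
      omega
  have hUV : ∀ j ∈ Finset.Icc 1 (n1 + (d - 1) - d + 1), win U j d = win V j d := fun j hj =>
    win_congr fun p hp => by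
      rw [Finset.mem_Icc] at hj
      rw [hU _ (by omega) (by omega), hV _ (by omega) (by omega)]
  rw [sub_pos, Nat.cast_lt,
    mapEq_lt_mapEq_iff (by omega) (Finset.mem_Icc.2 (by omega)) hUV, hT1]
  constructor
  · rintro ⟨j, hj, hk⟩
    rw [← hT2 j hj] at hk
    rw [Finset.mem_Icc] at hj
    exact ⟨n1 + j, Finset.mem_Ioc.2 (by omega), hk⟩
  · rintro ⟨j, hj, hk⟩
    rw [Finset.mem_Ioc] at hj
    obtain ⟨l, rfl⟩ : ∃ l, j = n1 + l := ⟨j - n1, by omega⟩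
    have hl : l ∈ Finset.Icc 1 (n2 - d + 1) := Finset.mem_Icc.2 (by omega)
    exact ⟨l, hl, hT2 l hl ▸ hk⟩
end
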